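/- arXiv:1407.3395 — 2 statements merged into one kernel-verified Lean document; each statement's English description precedes it below -/
import Mathlib

section
/- For every v ∈ (1/α,1) the quantity ‖Φ_α(·,v)‖_{L^α(ℝ)} = (∫_ℝ |Φ_α(u,v)|^α du)^{1/α} is finite, and the map v ↦ ‖Φ_α(·,v)‖_{L^α(ℝ)} is Lipschitz continuous on (1/α,1): there exists a finite constant c₀ > 0 (depending only on α and L) such that |‖Φ_α(·,v₂)‖_{L^α(ℝ)} − ‖Φ_α(·,v₁)‖_{L^α(ℝ)}| ≤ c₀ |v₂ − v₁| for all v₁, v₂ ∈ (1/α,1). -/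
open MeasureTheory

/-- `(x)_+^κ = x^κ` if `x > 0`, and `0` otherwise. -/
noncomputable def posPow (x κ : ℝ) : ℝ := if 0 < x then x ^ κ else 0

/-- `Φ_α(u,v) = Σ_{l=0}^L a_l (l−u)_+^{v−1/α}` with `a_l = (−1)^{L−l}·(L choose l)`. -/
noncomputable def Phi (α : ℝ) (L : ℕ) (u v : ℝ) : ℝ :=
  ∑ l ∈ Finset.range (L + 1),
    ((-1 : ℝ) ^ (L - l) * (L.choose l : ℝ)) * posPow ((l : ℝ) - u) (v - 1 / α)

/-- `‖Φ_α(·,v)‖_{L^α(ℝ)} = (∫_ℝ |Φ_α(u,v)|^α du)^{1/α}`. -/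
noncomputable def PhiNorm (α : ℝ) (L : ℕ) (v : ℝ) : ℝ :=
  (∫ u : ℝ, |Phi α L u v| ^ α) ^ (1 / α)

open scoped fwdDiff

/-! ### Bounds for iterated forward differences -/

theorem abs_fwdDiff_iter_le {f : ℝ → ℝ} {x M : ℝ} (hf : ∀ y, x ≤ y → |f y| ≤ M) (n : ℕ) :
    ∀ y, x ≤ y → |Δ_[1] ^[n] f y| ≤ 2 ^ n * M := by
  induction n with
  | zero => simpa using hf
  | succ n ih =>
    intro y hy
    rw [Function.iterate_succ_apply', fwdDiff]
    have h₁ := ih (y + 1) (by linarith)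
    have h₂ := ih y hy
    calc _ ≤ _ := abs_sub _ _
      _ ≤ 2 ^ (n + 1) * M := by rw [pow_succ]; linarith

theorem abs_fwdDiff_le_of_hasDerivAt {f f' : ℝ → ℝ} {x M : ℝ}
    (hf : ∀ y, x ≤ y → HasDerivAt f (f' y) y) (hM : ∀ y, x ≤ y → |f' y| ≤ M) :
    ∀ y, x ≤ y → |Δ_[1] f y| ≤ M := by
  intro y hy
  have h := (convex_Ici x).norm_image_sub_le_of_norm_hasDerivWithin_le
    (fun z hz => (hf z hz).hasDerivWithinAt) (fun z hz => hM z hz)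
    (show y ∈ Set.Ici x from hy) (show y + 1 ∈ Set.Ici x from by simp; linarith)
  simpa [fwdDiff] using h

/-- An iterated forward difference of order at least two is controlled by the second derivative. -/
theorem abs_fwdDiff_iter_le_of_hasDerivAt {f f' f'' : ℝ → ℝ} {x M : ℝ}
    (hf : ∀ y, x ≤ y → HasDerivAt f (f' y) y) (hf' : ∀ y, x ≤ y → HasDerivAt f' (f'' y) y)
    (hM : ∀ y, x ≤ y → |f'' y| ≤ M) {n : ℕ} (hn : 2 ≤ n) :
    |Δ_[1] ^[n] f x| ≤ 2 ^ (n - 2) * M := by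
  obtain ⟨k, rfl⟩ := Nat.exists_eq_add_of_le' hn
  have h₁ := abs_fwdDiff_le_of_hasDerivAt hf' hM
  have h₂ : ∀ y, x ≤ y → |Δ_[1] (Δ_[1] f) y| ≤ M := by
    refine abs_fwdDiff_le_of_hasDerivAt (f' := Δ_[1] f') (fun y hy => ?_) h₁
    exact ((hf (y + 1) (by linarith)).comp_add_const y 1).sub (hf y hy)
  rw [Function.iterate_add_apply]
  exact abs_fwdDiff_iter_le h₂ k x le_rfl

/-! ### Power functions as functions of the exponent -/

theorem abs_rpow_sub_rpow_le {y : ℝ} (hy : 0 < y) {a b : ℝ} (ha : a ∈ Set.Icc (0 : ℝ) (1 / 2))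
    (hb : b ∈ Set.Icc (0 : ℝ) (1 / 2)) :
    |y ^ b - y ^ a| ≤ 4 * (1 + y) * y ^ (-(1 / 4) : ℝ) * |b - a| := by
  refine (convex_Icc (0 : ℝ) (1 / 2)).norm_image_sub_le_of_norm_hasDerivWithin_le
    (f := fun k => y ^ k) (f' := fun k => y ^ k * Real.log y)
    (fun k _ => (Real.hasStrictDerivAt_const_rpow hy k).hasDerivAt.hasDerivWithinAt)
    (fun k hk => ?_) ha hb
  have hpos := Real.rpow_pos_of_pos hy
  rw [Real.norm_eq_abs, abs_mul, abs_of_pos (hpos k)]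
  rcases le_total y 1 with h | h
  · have h₁ : y ^ k ≤ 1 := Real.rpow_le_one hy.le h hk.1
    have h₂ : |Real.log y| ≤ 4 * y ^ (-(1 / 4) : ℝ) := by
      have := Real.log_le_rpow_div (inv_pos.2 hy).le (show (0 : ℝ) < 1 / 4 by norm_num)
      rw [Real.log_inv, Real.inv_rpow hy.le, ← Real.rpow_neg hy.le] at this
      rw [abs_of_nonpos (Real.log_nonpos hy.le h)]
      linarith
    have := hpos (-(1 / 4))
    calc y ^ k * |Real.log y| ≤ 1 * (4 * y ^ (-(1 / 4) : ℝ)) := by gcongr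
      _ ≤ _ := by nlinarith
  · have h₁ : y ^ k ≤ y ^ (1 / 2 : ℝ) := Real.rpow_le_rpow_of_exponent_le h hk.2
    have h₂ : |Real.log y| ≤ 4 * y ^ (1 / 4 : ℝ) := by
      have := Real.log_le_rpow_div hy.le (show (0 : ℝ) < 1 / 4 by norm_num)
      rw [abs_of_nonneg (Real.log_nonneg h)]
      linarith
    have := hpos (-(1 / 4))
    calc y ^ k * |Real.log y| ≤ y ^ (1 / 2 : ℝ) * (4 * y ^ (1 / 4 : ℝ)) := by gcongr
      _ = 4 * (y * y ^ (-(1 / 4) : ℝ)) := by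
        nth_rewrite 3 [← Real.rpow_one y]
        rw [mul_left_comm, ← Real.rpow_add hy, ← Real.rpow_add hy]
        norm_num
      _ ≤ _ := by nlinarith

theorem abs_second_deriv_rpow_sub_le {y : ℝ} (hy : 1 ≤ y) {a b : ℝ}
    (ha : a ∈ Set.Icc (0 : ℝ) (1 / 2)) (hb : b ∈ Set.Icc (0 : ℝ) (1 / 2)) :
    |b * ((b - 1) * y ^ (b - 1 - 1)) - a * ((a - 1) * y ^ (a - 1 - 1))|
      ≤ 5 * y ^ (-(5 / 4) : ℝ) * |b - a| := by
  have hy0 : 0 < y := by linarith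
  refine (convex_Icc (0 : ℝ) (1 / 2)).norm_image_sub_le_of_norm_hasDerivWithin_le
    (f := fun k => k * ((k - 1) * y ^ (k - 1 - 1)))
    (f' := fun k => (2 * k - 1 + k * (k - 1) * Real.log y) * y ^ (k - 1 - 1))
    (fun k _ => ?_) (fun k hk => ?_) ha hb
  · have h₁ : HasDerivAt (fun k : ℝ => y ^ (k - 1 - 1)) (y ^ (k - 1 - 1) * Real.log y) k := by
      exact (((Real.hasStrictDerivAt_const_rpow hy0 (k - 1 - 1)).hasDerivAt.comp k
        (((hasDerivAt_id k).sub_const 1).sub_const 1)).congr_deriv (mul_one _))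
    have h₂ := (hasDerivAt_id k).mul (((hasDerivAt_id k).sub_const 1).mul h₁)
    refine (h₂.congr_deriv ?_).hasDerivWithinAt
    simp only [id, Pi.mul_apply]
    ring
  · obtain ⟨hk0, hk1⟩ := hk
    have hlog := Real.log_nonneg hy
    have hlog' : Real.log y ≤ 4 * y ^ (1 / 4 : ℝ) := by
      have := Real.log_le_rpow_div hy0.le (show (0 : ℝ) < 1 / 4 by norm_num)
      linarith
    have hone : 1 ≤ y ^ (1 / 4 : ℝ) := Real.one_le_rpow hy (by norm_num)
    have hcoef : |2 * k - 1 + k * (k - 1) * Real.log y| ≤ 5 * y ^ (1 / 4 : ℝ) := by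
      have h₁ : 0 ≤ k * (1 - k) := by nlinarith
      have h₂ : k * (1 - k) ≤ 1 := by nlinarith
      have h₃ : k * (1 - k) * Real.log y ≤ 1 * Real.log y := by gcongr
      have h₄ : 0 ≤ k * (1 - k) * Real.log y := by positivity
      rw [abs_le]
      constructor <;> nlinarith
    have hexp : y ^ (k - 1 - 1) ≤ y ^ (-(3 / 2) : ℝ) :=
      Real.rpow_le_rpow_of_exponent_le hy (by linarith)
    rw [Real.norm_eq_abs, abs_mul, abs_of_pos (Real.rpow_pos_of_pos hy0 _)]
    calc _ ≤ (5 * y ^ (1 / 4 : ℝ)) * y ^ (-(3 / 2) : ℝ) := by gcongr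
      _ = 5 * y ^ (-(5 / 4) : ℝ) := by
        rw [mul_assoc, ← Real.rpow_add hy0]
        norm_num

/-! ### The dominating function -/

/-- The integrable majorant of the difference quotients of `v ↦ Φ_α(u,v)`. -/
noncomputable def phiMajorant (L : ℕ) (u : ℝ) : ℝ :=
  (2 ^ L * (4 * (L + 2))) *
    (∑ l ∈ Finset.range (L + 1),
        (Set.Ioc (0 : ℝ) (L + 1)).indicator (fun x => x ^ (-(1 / 4) : ℝ)) ((l : ℝ) - u)
      + (Set.Ioi (1 : ℝ)).indicator (fun x => x ^ (-(5 / 4) : ℝ)) (0 - u))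

theorem memLp_indicator_rpow {α c : ℝ} (hα : 0 < α) {s : Set ℝ} (hs : MeasurableSet s)
    (hs0 : s ⊆ Set.Ioi 0) (h : IntegrableOn (fun x => x ^ (c * α)) s) :
    MemLp (s.indicator (fun x => x ^ c)) (ENNReal.ofReal α) := by
  have hp : ENNReal.ofReal α ≠ 0 := by simpa using hα
  rw [memLp_indicator_iff_restrict hs,
    ← integrable_norm_rpow_iff (by fun_prop) hp ENNReal.ofReal_ne_top,
    ENNReal.toReal_ofReal hα.le]
  refine IntegrableOn.congr_fun h (fun x hx => ?_) hs
  have hx0 : 0 < x := hs0 hx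
  simp only [Real.norm_eq_abs]
  rw [abs_of_pos (Real.rpow_pos_of_pos hx0 _), ← Real.rpow_mul hx0.le]

theorem memLp_phiMajorant {α : ℝ} (hα : α ∈ Set.Ioo (1 : ℝ) 2) (L : ℕ) :
    MemLp (phiMajorant L) (ENNReal.ofReal α) := by
  obtain ⟨h1, h2⟩ := hα
  have hL : (0 : ℝ) ≤ L + 1 := by positivity
  have hnear : MemLp ((Set.Ioc (0 : ℝ) (L + 1)).indicator (fun x => x ^ (-(1 / 4) : ℝ)))
      (ENNReal.ofReal α) := by
    refine memLp_indicator_rpow (by linarith) measurableSet_Ioc (fun x hx => hx.1) ?_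
    rw [← intervalIntegrable_iff_integrableOn_Ioc_of_le hL]
    exact intervalIntegral.intervalIntegrable_rpow' (by linarith)
  have hfar : MemLp ((Set.Ioi (1 : ℝ)).indicator (fun x => x ^ (-(5 / 4) : ℝ)))
      (ENNReal.ofReal α) :=
    memLp_indicator_rpow (by linarith) measurableSet_Ioi
      (Set.Ioi_subset_Ioi zero_le_one) (integrableOn_Ioi_rpow_of_lt (by linarith) one_pos)
  have hsum := memLp_finsetSum (Finset.range (L + 1)) fun l _ =>
    hnear.comp_measurePreserving (volume.measurePreserving_sub_left (l : ℝ))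
  have hadd := hsum.add
    (hfar.comp_measurePreserving (volume.measurePreserving_sub_left (0 : ℝ)))
  exact hadd.const_mul (2 ^ L * (4 * (L + 2)))

theorem Phi_eq_fwdDiff_iter (α : ℝ) (L : ℕ) {u : ℝ} (hu : u < 0) (v : ℝ) :
    Phi α L u v = Δ_[1] ^[L] (fun y : ℝ => y ^ (v - 1 / α)) (-u) := by
  rw [fwdDiff_iter_eq_sum_shift, Phi]
  refine Finset.sum_congr rfl fun l _ => ?_
  have : (0 : ℝ) < l - u := by
    have : (0 : ℝ) ≤ l := l.cast_nonneg
    linarith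
  rw [posPow, if_pos this, zsmul_eq_mul, nsmul_one, neg_add_eq_sub]
  push_cast
  rfl

theorem abs_neg_one_pow_mul_choose_le (L l : ℕ) :
    |(-1 : ℝ) ^ (L - l) * (L.choose l : ℝ)| ≤ 2 ^ L := by
  rw [abs_mul, abs_pow, abs_neg, abs_one, one_pow, one_mul, Nat.abs_cast]
  exact_mod_cast Nat.choose_le_two_pow L l

theorem abs_Phi_sub_le {α : ℝ} {L : ℕ} (hL : 2 ≤ L) {v₁ v₂ : ℝ}
    (h₁ : v₁ - 1 / α ∈ Set.Icc (0 : ℝ) (1 / 2)) (h₂ : v₂ - 1 / α ∈ Set.Icc (0 : ℝ) (1 / 2))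
    (u : ℝ) : |Phi α L u v₂ - Phi α L u v₁| ≤ |v₂ - v₁| * phiMajorant L u := by
  have hsub : v₂ - 1 / α - (v₁ - 1 / α) = v₂ - v₁ := by ring
  have hnear0 : ∀ x : ℝ, 0 ≤
      (Set.Ioc (0 : ℝ) (L + 1)).indicator (fun x => x ^ (-(1 / 4) : ℝ)) x := fun x =>
    Set.indicator_nonneg (fun x hx => Real.rpow_nonneg hx.1.le _) x
  have hfar0 : ∀ x : ℝ, 0 ≤
      (Set.Ioi (1 : ℝ)).indicator (fun x => x ^ (-(5 / 4) : ℝ)) x := fun x =>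
    Set.indicator_nonneg (fun x hx => Real.rpow_nonneg (zero_le_one.trans (le_of_lt hx)) _) x
  rw [phiMajorant]
  rcases lt_or_ge u (-1) with hu | hu
  · have hfar : (Set.Ioi (1 : ℝ)).indicator (fun x => x ^ (-(5 / 4) : ℝ)) (0 - u)
        = (-u) ^ (-(5 / 4) : ℝ) := by
      rw [zero_sub, Set.indicator_of_mem (show -u ∈ Set.Ioi (1 : ℝ) by simp; linarith)]
    have hpow : 0 < (-u) ^ (-(5 / 4) : ℝ) := Real.rpow_pos_of_pos (by linarith) _
    have key : |Phi α L u v₂ - Phi α L u v₁|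
        ≤ 2 ^ (L - 2) * (5 * (-u) ^ (-(5 / 4) : ℝ) * |v₂ - v₁|) := by
      rw [Phi_eq_fwdDiff_iter α L (by linarith), Phi_eq_fwdDiff_iter α L (by linarith)]
      have hlin : Δ_[1] ^[L] (fun y : ℝ => y ^ (v₂ - 1 / α)) (-u)
          - Δ_[1] ^[L] (fun y : ℝ => y ^ (v₁ - 1 / α)) (-u)
          = Δ_[1] ^[L] (fun y : ℝ => y ^ (v₂ - 1 / α) - y ^ (v₁ - 1 / α)) (-u) := by
        simp only [fwdDiff_iter_eq_sum_shift, ← Finset.sum_sub_distrib, smul_sub]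
      rw [hlin]
      refine abs_fwdDiff_iter_le_of_hasDerivAt
        (fun y hy => (Real.hasDerivAt_rpow_const (Or.inl ?_)).sub
          (Real.hasDerivAt_rpow_const (Or.inl ?_)))
        (fun y hy => ((Real.hasDerivAt_rpow_const (Or.inl ?_)).const_mul _).sub
          ((Real.hasDerivAt_rpow_const (Or.inl ?_)).const_mul _)) (fun y hy => ?_) hL
      any_goals intro h; linarith
      refine (abs_second_deriv_rpow_sub_le (by linarith) h₁ h₂).trans ?_
      rw [hsub]
      gcongr ?_ * ?_ * _
      exact Real.rpow_le_rpow_of_nonpos (by linarith) hy (by norm_num)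
    refine key.trans ?_
    rw [hfar]
    have hpow2 : (2 : ℝ) ^ (L - 2) ≤ 2 ^ L := pow_le_pow_right₀ one_le_two (Nat.sub_le _ _)
    have hL' : (5 : ℝ) ≤ 4 * (L + 2) := by
      have : (0 : ℝ) ≤ L := L.cast_nonneg
      linarith
    have hsum := Finset.sum_nonneg fun l (_ : l ∈ Finset.range (L + 1)) => hnear0 ((l : ℝ) - u)
    calc _ = |v₂ - v₁| * ((2 ^ (L - 2) * 5) * (0 + (-u) ^ (-(5 / 4) : ℝ))) := by ring
      _ ≤ _ := by gcongr
  · have key : ∀ l ∈ Finset.range (L + 1),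
        |posPow ((l : ℝ) - u) (v₂ - 1 / α) - posPow ((l : ℝ) - u) (v₁ - 1 / α)| ≤
        4 * (L + 2) * (Set.Ioc (0 : ℝ) (L + 1)).indicator
          (fun x => x ^ (-(1 / 4) : ℝ)) ((l : ℝ) - u) * |v₂ - v₁| := by
      intro l hl
      have hlL : (l : ℝ) ≤ L := by exact_mod_cast Finset.mem_range_succ_iff.1 hl
      unfold posPow
      split_ifs with hx
      · rw [Set.indicator_of_mem (show (l : ℝ) - u ∈ Set.Ioc (0 : ℝ) (L + 1) from
          ⟨hx, by linarith⟩)]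
        refine (abs_rpow_sub_rpow_le hx h₁ h₂).trans ?_
        rw [hsub]
        have := Real.rpow_pos_of_pos hx (-(1 / 4))
        gcongr ?_ * _ * _
        linarith
      · have := hnear0 ((l : ℝ) - u)
        rw [sub_zero, abs_zero]
        positivity
    rw [Phi, Phi, ← Finset.sum_sub_distrib]
    calc _ ≤ ∑ l ∈ Finset.range (L + 1), 2 ^ L * (4 * (L + 2) *
          (Set.Ioc (0 : ℝ) (L + 1)).indicator
            (fun x => x ^ (-(1 / 4) : ℝ)) ((l : ℝ) - u) * |v₂ - v₁|) := by
          refine (Finset.abs_sum_le_sum_abs _ _).trans (Finset.sum_le_sum fun l hl => ?_)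
          rw [← mul_sub, abs_mul]
          exact mul_le_mul (abs_neg_one_pow_mul_choose_le L l) (key l hl) (abs_nonneg _)
            (by positivity)
      _ = |v₂ - v₁| * ((2 ^ L * (4 * (L + 2))) * (∑ l ∈ Finset.range (L + 1),
          (Set.Ioc (0 : ℝ) (L + 1)).indicator
            (fun x => x ^ (-(1 / 4) : ℝ)) ((l : ℝ) - u) + 0)) := by
          rw [add_zero, Finset.mul_sum, Finset.mul_sum]
          exact Finset.sum_congr rfl fun l _ => by ring
      _ ≤ _ := by
          gcongr
          exact hfar0 _

/-! ### Membership in `L^α` -/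

theorem measurable_Phi (α : ℝ) (L : ℕ) (v : ℝ) : Measurable (fun u => Phi α L u v) := by
  unfold Phi posPow
  refine Finset.measurable_fun_sum _ fun l _ => Measurable.const_mul ?_ _
  exact Measurable.ite (measurableSet_lt measurable_const (by fun_prop)) (by fun_prop)
    measurable_const

theorem memLp_Phi_one_div (α : ℝ) {L : ℕ} (hL : 2 ≤ L) :
    MemLp (fun u => Phi α L u (1 / α)) (ENNReal.ofReal α) := by
  have hbound : MemLp ((Set.Icc (0 : ℝ) L).indicator fun _ => ((L + 1 : ℕ) : ℝ) * 2 ^ L)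
      (ENNReal.ofReal α) :=
    memLp_indicator_const _ measurableSet_Icc _ (Or.inr (by simp))
  refine hbound.mono' (measurable_Phi α L _).aestronglyMeasurable (.of_forall fun u => ?_)
  rw [Real.norm_eq_abs]
  by_cases hu : u ∈ Set.Icc (0 : ℝ) L
  · rw [Set.indicator_of_mem hu, Phi]
    refine (Finset.abs_sum_le_sum_abs _ _).trans ?_
    nth_rewrite 2 [← Finset.card_range (L + 1)]
    rw [← nsmul_eq_mul]
    refine Finset.sum_le_card_nsmul _ _ _ fun l _ => ?_
    have hpos : |posPow ((l : ℝ) - u) (1 / α - 1 / α)| ≤ 1 := by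
      unfold posPow
      split_ifs <;> simp
    rw [abs_mul, ← mul_one ((2 : ℝ) ^ _)]
    exact mul_le_mul (abs_neg_one_pow_mul_choose_le L l) hpos (abs_nonneg _) (by positivity)
  · rw [Set.indicator_of_notMem hu]
    rw [Set.mem_Icc, not_and_or, not_le, not_le] at hu
    rcases hu with hu | hu
    · rw [Phi_eq_fwdDiff_iter α L hu]
      have h := abs_fwdDiff_iter_le_of_hasDerivAt (f := fun _ : ℝ => (1 : ℝ)) (x := -u)
        (fun y _ => hasDerivAt_const y (1 : ℝ)) (fun y _ => hasDerivAt_const y (0 : ℝ))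
        (M := 0) (by simp) hL
      simpa using h
    · rw [Phi, Finset.sum_eq_zero, abs_zero]
      intro l hl
      have hlL : (l : ℝ) ≤ L := by exact_mod_cast Finset.mem_range_succ_iff.1 hl
      rw [posPow, if_neg (by linarith), mul_zero]

theorem memLp_Phi {α : ℝ} (hα : α ∈ Set.Ioo (1 : ℝ) 2) {L : ℕ} (hL : 2 ≤ L) {v : ℝ}
    (hv : v - 1 / α ∈ Set.Icc (0 : ℝ) (1 / 2)) :
    MemLp (fun u => Phi α L u v) (ENNReal.ofReal α) := by
  have hmeas := ((measurable_Phi α L v).sub (measurable_Phi α L (1 / α))).aestronglyMeasurable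
    (μ := volume)
  have hdiff : MemLp ((fun u => Phi α L u v) - fun u => Phi α L u (1 / α)) (ENNReal.ofReal α) :=
    ((memLp_phiMajorant hα L).const_mul |v - 1 / α|).mono' hmeas
      (.of_forall fun u => abs_Phi_sub_le hL (by norm_num) hv u)
  simpa using hdiff.add (memLp_Phi_one_div α hL)

theorem PhiNorm_eq_lpNorm {α : ℝ} (hα : 0 < α) (L : ℕ) (v : ℝ) :
    PhiNorm α L v = lpNorm (fun u => Phi α L u v) (ENNReal.ofReal α) volume := by
  rw [lpNorm_eq_integral_norm_rpow_toReal (by simpa using hα) ENNReal.ofReal_ne_top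
    (measurable_Phi α L v).aestronglyMeasurable, ENNReal.toReal_ofReal hα.le, PhiNorm, one_div]
  rfl

theorem PhiNorm_le_add {α : ℝ} (hα : α ∈ Set.Ioo (1 : ℝ) 2) {L : ℕ} (hL : 2 ≤ L) {v₁ v₂ : ℝ}
    (h₁ : v₁ - 1 / α ∈ Set.Icc (0 : ℝ) (1 / 2)) (h₂ : v₂ - 1 / α ∈ Set.Icc (0 : ℝ) (1 / 2)) :
    PhiNorm α L v₂ ≤ PhiNorm α L v₁
      + |v₂ - v₁| * lpNorm (phiMajorant L) (ENNReal.ofReal α) volume := by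
  have hα0 : 0 < α := zero_lt_one.trans hα.1
  have hp : 1 ≤ ENNReal.ofReal α := by simpa using hα.1.le
  rw [PhiNorm_eq_lpNorm hα0, PhiNorm_eq_lpNorm hα0]
  have hmaj : lpNorm ((fun u => Phi α L u v₂) - fun u => Phi α L u v₁) (ENNReal.ofReal α) volume
      ≤ lpNorm (|v₂ - v₁| • phiMajorant L) (ENNReal.ofReal α) volume :=
    lpNorm_mono_real ((memLp_phiMajorant hα L).const_smul _)
      fun u => abs_Phi_sub_le hL h₁ h₂ u
  rw [lpNorm_const_smul] at hmaj
  have htri := lpNorm_le_lpNorm_add_lpNorm_sub' (f := fun u => Phi α L u v₂)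
    (memLp_Phi hα hL h₁) hp
  simp only [coe_nnnorm, Real.norm_eq_abs, abs_abs] at hmaj
  linarith

/-- For every `v ∈ (1/α,1)` the quantity `‖Φ_α(·,v)‖_{L^α(ℝ)}` is finite
(i.e. `u ↦ |Φ_α(u,v)|^α` is integrable), and `v ↦ ‖Φ_α(·,v)‖_{L^α(ℝ)}` is Lipschitz
continuous on `(1/α,1)` with a Lipschitz constant `c₀ > 0` depending only on `α, L`. -/
theorem PhiNorm_finite_and_lipschitz (α : ℝ) (hα : α ∈ Set.Ioo (1 : ℝ) 2) (L : ℕ)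
    (hL : 2 ≤ L) :
    (∀ v ∈ Set.Ioo (1 / α) (1 : ℝ),
      Integrable (fun u : ℝ => |Phi α L u v| ^ α)) ∧
    ∃ c₀ > (0 : ℝ), ∀ v₁ ∈ Set.Ioo (1 / α) (1 : ℝ), ∀ v₂ ∈ Set.Ioo (1 / α) (1 : ℝ),
      |PhiNorm α L v₂ - PhiNorm α L v₁| ≤ c₀ * |v₂ - v₁| := by
  have hκ : ∀ v ∈ Set.Ioo (1 / α) (1 : ℝ), v - 1 / α ∈ Set.Icc (0 : ℝ) (1 / 2) := by
    rintro v ⟨hv₁, hv₂⟩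
    have : 1 / 2 ≤ 1 / α := one_div_le_one_div_of_le (zero_lt_one.trans hα.1) hα.2.le
    exact ⟨by linarith, by linarith⟩
  have hα0 : 0 < α := zero_lt_one.trans hα.1
  refine ⟨fun v hv => ?_, lpNorm (phiMajorant L) (ENNReal.ofReal α) volume + 1,
    by have := lpNorm_nonneg (f := phiMajorant L) (p := ENNReal.ofReal α) (μ := volume); linarith,
    fun v₁ hv₁ v₂ hv₂ => ?_⟩
  · have h := (memLp_Phi hα hL (hκ v hv)).integrable_norm_rpow (by simpa using hα0)
      ENNReal.ofReal_ne_top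
    rwa [ENNReal.toReal_ofReal hα0.le] at h
  · have h₁ := PhiNorm_le_add hα hL (hκ v₁ hv₁) (hκ v₂ hv₂)
    have h₂ := PhiNorm_le_add hα hL (hκ v₂ hv₂) (hκ v₁ hv₁)
    rw [abs_sub_comm v₁ v₂] at h₂
    have := abs_nonneg (v₂ - v₁)
    rw [abs_le]
    constructor <;> linarith
end

section
/- Let β ∈ (0,1/4] and let H : [0,1] → [H̲,H̄] with 1/α < H̲ ≤ H̄ < 1 satisfy |H(t₁) − H(t₂)| ≤ c_H |t₁ − t₂|^{ρ_H} for all t₁,t₂ ∈ [0,1], where c_H > 0 and H̄ < ρ_H ≤ 1. Then there exists a constant c > 0 (not depending on I and N) such that for every compact interval I ⊆ [0,1] and every integer N ≥ 4 with λ(I) ≥ 4(L+1) N^{−1} (log N)², one has ( Σ_{k ∈ ν_N(I)} ‖Φ_α(·, H(k/N))‖_{L^α(ℝ)}^β · N^{−β H(k/N)} )^{−1} ≤ c · |ν_N(I)|^{−1} · N^{β H̲(I)} · (log N)², where H̲(I) = min_{t ∈ I} H(t). -/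
open MeasureTheory
open scoped Classical

lemma posPow_eq_max_rpow (x : ℝ) {κ : ℝ} (hκ : κ ≠ 0) : posPow x κ = max x 0 ^ κ := by
  unfold posPow
  split_ifs with h
  · rw [max_eq_left h.le]
  · rw [max_eq_right (not_lt.1 h), Real.zero_rpow hκ]

lemma continuous_Phi {α v : ℝ} (L : ℕ) (hv : 1 / α < v) :
    Continuous fun u => Phi α L u v := by
  have hκ : 0 < v - 1 / α := sub_pos.2 hv
  simp only [Phi, posPow_eq_max_rpow _ hκ.ne']
  refine continuous_finsetSum _ fun l _ => continuous_const.mul ?_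
  exact Continuous.rpow_const (by fun_prop) fun _ => Or.inr hκ.le

lemma Phi_eq_zero {α v u : ℝ} {L : ℕ} (hu : (L : ℝ) ≤ u) : Phi α L u v = 0 := by
  refine Finset.sum_eq_zero fun l hl => ?_
  have hl' : (l : ℝ) ≤ L := by exact_mod_cast Nat.lt_succ_iff.1 (Finset.mem_range.1 hl)
  rw [posPow, if_neg (by linarith), mul_zero]

lemma Phi_eq_rpow {α v u : ℝ} {L : ℕ} (hu : (L : ℝ) - 1 ≤ u) (hu' : u < L) :
    Phi α L u v = (L - u) ^ (v - 1 / α) := by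
  rw [Phi, Finset.sum_range_succ, Finset.sum_eq_zero, posPow, if_pos (by linarith)]
  · simp
  · intro l hl
    have hl' : (l : ℝ) + 1 ≤ L := by exact_mod_cast Finset.mem_range.1 hl
    rw [posPow, if_neg (by linarith), mul_zero]

lemma sum_range_neg_one_pow_sub_mul_choose {L : ℕ} (hL : L ≠ 0) :
    ∑ l ∈ Finset.range (L + 1), ((-1 : ℝ) ^ (L - l) * (L.choose l : ℝ)) = 0 := by
  simpa [hL] using (add_pow (1 : ℝ) (-1) L).symm

lemma rpow_add_sub_rpow_le {x y κ : ℝ} (hx : 0 < x) (hy : 0 ≤ y) (h0 : 0 ≤ κ) (h1 : κ ≤ 1) :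
    |(x + y) ^ κ - x ^ κ| ≤ y * x ^ (κ - 1) := by
  have hyx : 0 ≤ y / x := by positivity
  have hb := rpow_one_add_le_one_add_mul_self (by linarith : -1 ≤ y / x) h0 h1
  have hxy : x + y = x * (1 + y / x) := by field_simp
  rw [abs_of_nonneg (sub_nonneg.2 (Real.rpow_le_rpow hx.le (by linarith) h0)), hxy,
    Real.mul_rpow hx.le (by linarith), Real.rpow_sub_one hx.ne']
  have h2 : (1 + y / x) ^ κ ≤ 1 + y / x := hb.trans (by nlinarith)
  calc x ^ κ * (1 + y / x) ^ κ - x ^ κ ≤ x ^ κ * (1 + y / x) - x ^ κ := by gcongr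
    _ = y * (x ^ κ / x) := by ring

lemma exists_abs_Phi_le {α v : ℝ} {L : ℕ} (hL : L ≠ 0) (hv : 1 / α < v) (hv' : v - 1 / α ≤ 1) :
    ∃ C, 0 ≤ C ∧ ∀ u < 0, |Phi α L u v| ≤ C * (-u) ^ (v - 1 / α - 1) := by
  refine ⟨∑ l ∈ Finset.range (L + 1), |(-1 : ℝ) ^ (L - l) * (L.choose l : ℝ)| * l,
    by positivity, fun u hu => ?_⟩
  have hx : 0 < -u := by linarith
  have key : Phi α L u v = ∑ l ∈ Finset.range (L + 1), ((-1 : ℝ) ^ (L - l) * (L.choose l : ℝ)) *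
      ((-u + l) ^ (v - 1 / α) - (-u) ^ (v - 1 / α)) := by
    simp only [mul_sub, Finset.sum_sub_distrib, ← Finset.sum_mul,
      sum_range_neg_one_pow_sub_mul_choose hL, zero_mul, sub_zero]
    refine Finset.sum_congr rfl fun l _ => ?_
    have : (0 : ℝ) ≤ l := l.cast_nonneg
    rw [posPow, if_pos (by linarith), sub_eq_neg_add]
  rw [key, Finset.sum_mul]
  refine (Finset.abs_sum_le_sum_abs _ _).trans (Finset.sum_le_sum fun l _ => ?_)
  rw [abs_mul, mul_assoc]
  exact mul_le_mul_of_nonneg_left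
    (rpow_add_sub_rpow_le hx l.cast_nonneg (by linarith) hv') (abs_nonneg _)

lemma integrable_abs_Phi_rpow {α v : ℝ} {L : ℕ} (hα : 1 < α) (hL : L ≠ 0) (hv : 1 / α < v)
    (hv' : v < 1) : Integrable fun u => |Phi α L u v| ^ α := by
  have hα0 : 0 < α := by linarith
  have hinv : 0 < 1 / α := by positivity
  have hcont : Continuous fun u => |Phi α L u v| ^ α :=
    (continuous_Phi L hv).abs.rpow_const fun _ => Or.inr hα0.le
  obtain ⟨C, hC, hbound⟩ := exists_abs_Phi_le hL hv (by linarith)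
  have hleft : IntegrableOn (fun u => |Phi α L u v| ^ α) (Set.Iio (-1)) := by
    have hexp : (v - 1 / α - 1) * α < -1 := by
      have : (v - 1 / α - 1) * α = v * α - 1 - α := by field_simp
      nlinarith
    have hpow : IntegrableOn (fun u : ℝ => C ^ α * (-u) ^ ((v - 1 / α - 1) * α))
        (Set.Iio (-1)) := by
      refine Integrable.const_mul (IntegrableOn.comp_neg_Iio
        (f := fun x : ℝ => x ^ ((v - 1 / α - 1) * α)) ?_) _
      rw [neg_neg]
      exact integrableOn_Ioi_rpow_of_lt hexp one_pos
    refine hpow.mono' hcont.aestronglyMeasurable.restrict ?_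
    filter_upwards [ae_restrict_mem measurableSet_Iio] with u hu
    have hu0 : u < 0 := lt_trans hu (by norm_num)
    have hu1 : 0 ≤ -u := by linarith
    rw [Real.norm_of_nonneg (by positivity), Real.rpow_mul hu1,
      ← Real.mul_rpow hC (by positivity)]
    exact Real.rpow_le_rpow (abs_nonneg _) (hbound u hu0) hα0.le
  have hmid : IntegrableOn (fun u => |Phi α L u v| ^ α) (Set.Icc (-1) (L : ℝ)) :=
    hcont.continuousOn.integrableOn_compact isCompact_Icc
  have hright : IntegrableOn (fun u => |Phi α L u v| ^ α) (Set.Ici (L : ℝ)) := by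
    refine (integrableOn_zero (ε' := ℝ)).congr_fun (fun u hu => ?_) measurableSet_Ici
    simp only [Phi_eq_zero (Set.mem_Ici.1 hu), abs_zero, Real.zero_rpow hα0.ne']
  rw [← integrableOn_univ]
  refine ((hleft.union hmid).union hright).mono_set fun u _ => ?_
  simp only [Set.mem_union, Set.mem_Iio, Set.mem_Icc, Set.mem_Ici]
  grind

lemma one_eighth_le_PhiNorm {α v : ℝ} {L : ℕ} (hα : α ∈ Set.Ioo (1 : ℝ) 2) (hL : L ≠ 0)
    (hv : 1 / α < v) (hv' : v < 1) : 1 / 8 ≤ PhiNorm α L v := by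
  obtain ⟨hα1, hα2⟩ := hα
  have hinv : 0 < 1 / α := by positivity
  have hInt := integrable_abs_Phi_rpow hα1 hL hv hv'
  have hset : 1 / 4 * volume.real (Set.Icc ((L : ℝ) - 1) (L - 1 / 2)) ≤
      ∫ u in Set.Icc ((L : ℝ) - 1) (L - 1 / 2), |Phi α L u v| ^ α := by
    refine setIntegral_ge_of_const_le_real measurableSet_Icc (by simp) (fun u hu => ?_)
      hInt.integrableOn
    rw [Phi_eq_rpow hu.1 (by linarith [hu.2])]
    have hlow : (1 / 2 : ℝ) ≤ (L - u) ^ (v - 1 / α) :=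
      calc (1 / 2 : ℝ) = (1 / 2) ^ (1 : ℝ) := (Real.rpow_one _).symm
        _ ≤ (1 / 2) ^ (v - 1 / α) :=
          Real.rpow_le_rpow_of_exponent_ge (by norm_num) (by norm_num) (by linarith)
        _ ≤ (L - u) ^ (v - 1 / α) :=
          Real.rpow_le_rpow (by norm_num) (by linarith [hu.2]) (by linarith)
    calc (1 / 4 : ℝ) = (1 / 2) ^ (2 : ℝ) := by norm_num
      _ ≤ (1 / 2) ^ α :=
        Real.rpow_le_rpow_of_exponent_ge (by norm_num) (by norm_num) hα2.le
      _ ≤ |(L - u) ^ (v - 1 / α)| ^ α :=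
        Real.rpow_le_rpow (by norm_num) (hlow.trans (le_abs_self _)) (by linarith)
  have hfull : (1 / 8 : ℝ) ≤ ∫ u, |Phi α L u v| ^ α := by
    refine le_trans ?_ (hset.trans (setIntegral_le_integral hInt
      (Filter.Eventually.of_forall fun u => by positivity)))
    rw [Real.volume_real_Icc_of_le (by linarith)]
    linarith
  calc (1 / 8 : ℝ) = (1 / 8) ^ (1 : ℝ) := (Real.rpow_one _).symm
    _ ≤ (1 / 8) ^ (1 / α) := Real.rpow_le_rpow_of_exponent_ge (by norm_num) (by norm_num)
        ((div_le_one (by linarith)).2 hα1.le)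
    _ ≤ PhiNorm α L v := Real.rpow_le_rpow (by norm_num) hfull hinv.le

lemma le_card_filter_div_mem_Icc {N L : ℕ} (hN : 0 < N) (hLN : L ≤ N) {a b : ℝ} (ha : 0 ≤ a)
    (hb : b ≤ 1) :
    (N : ℝ) * (b - a) - L - 1 ≤
      (((Finset.range (N - L + 1)).filter fun k : ℕ => (k : ℝ) / N ∈ Set.Icc a b).card : ℝ) := by
  have hN' : (0 : ℝ) < N := by exact_mod_cast hN
  have hcard : ⌊(N : ℝ) * (b - a) - L⌋₊ ≤
      ((Finset.range (N - L + 1)).filter fun k : ℕ => (k : ℝ) / N ∈ Set.Icc a b).card := by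
    rw [← Finset.card_range ⌊(N : ℝ) * (b - a) - L⌋₊]
    refine Finset.card_le_card_of_injOn (fun j => ⌈(N : ℝ) * a⌉₊ + j) (fun j hj => ?_)
      fun i _ j _ h => by simpa using h
    have hj1 : j + 1 ≤ ⌊(N : ℝ) * (b - a) - L⌋₊ := by simpa using hj
    have hj2 : ((j + 1 : ℕ) : ℝ) ≤ (N : ℝ) * (b - a) - L :=
      (Nat.le_floor_iff' (Nat.succ_ne_zero j)).1 hj1
    push_cast at hj2
    have hc1 := Nat.le_ceil ((N : ℝ) * a)
    have hc2 := Nat.ceil_lt_add_one (mul_nonneg hN'.le ha)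
    have hNb : (N : ℝ) * b ≤ N := by nlinarith
    have hL0 : (0 : ℝ) ≤ L := L.cast_nonneg
    have hj0 : (0 : ℝ) ≤ j := j.cast_nonneg
    simp only [Finset.coe_filter, Finset.mem_range, Set.mem_ofPred_eq, Set.mem_Icc]
    refine ⟨?_, ?_, ?_⟩
    · have : ((⌈(N : ℝ) * a⌉₊ + j + L : ℕ) : ℝ) ≤ N := by push_cast; linarith
      have : ⌈(N : ℝ) * a⌉₊ + j + L ≤ N := by exact_mod_cast this
      omega
    · rw [le_div_iff₀ hN']; push_cast; linarith
    · rw [div_le_iff₀ hN']; push_cast; linarith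
  have hfl := Nat.lt_floor_add_one ((N : ℝ) * (b - a) - L)
  have : (⌊(N : ℝ) * (b - a) - L⌋₊ : ℝ) ≤ _ := Nat.cast_le.2 hcard
  linarith

lemma card_filter_div_mem_Icc_le {N : ℕ} (hN : 0 < N) (s : Finset ℕ) {a b : ℝ} (ha : 0 ≤ a)
    (hab : a ≤ b) :
    ((s.filter fun k : ℕ => (k : ℝ) / N ∈ Set.Icc a b).card : ℝ) ≤ N * (b - a) + 1 := by
  have hN' : (0 : ℝ) < N := by exact_mod_cast hN
  have hsub : (s.filter fun k : ℕ => (k : ℝ) / N ∈ Set.Icc a b) ⊆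
      Finset.Icc ⌈(N : ℝ) * a⌉₊ ⌊(N : ℝ) * b⌋₊ := by
    intro k hk
    obtain ⟨-, hk1, hk2⟩ := Finset.mem_filter.1 hk
    rw [le_div_iff₀ hN'] at hk1
    rw [div_le_iff₀ hN'] at hk2
    exact Finset.mem_Icc.2 ⟨Nat.ceil_le.2 (by linarith), Nat.le_floor (by linarith)⟩
  have hcard := Finset.card_le_card hsub
  rw [Nat.card_Icc] at hcard
  refine (Nat.cast_le.2 hcard).trans ?_
  have hc := Nat.le_ceil ((N : ℝ) * a)
  have hf := Nat.floor_le (mul_nonneg hN'.le (ha.trans hab))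
  rcases le_total ⌈(N : ℝ) * a⌉₊ (⌊(N : ℝ) * b⌋₊ + 1) with h | h
  · rw [Nat.cast_sub h]; push_cast; linarith
  · rw [Nat.sub_eq_zero_of_le h, Nat.cast_zero]; nlinarith

lemma exists_Icc_add_subset_near {u w r t : ℝ} (ht : t ∈ Set.Icc u w) (hr : 0 ≤ r)
    (hrw : r ≤ (w - u) / 2) :
    ∃ a, u ≤ a ∧ a + r ≤ w ∧ ∀ x ∈ Set.Icc a (a + r), |x - t| ≤ r := by
  rcases le_total t ((u + w) / 2) with h | h
  · exact ⟨t, ht.1, by linarith, fun x hx => abs_le.2 ⟨by linarith [hx.1], by linarith [hx.2]⟩⟩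
  · exact ⟨t - r, by linarith, by linarith [ht.2],
      fun x hx => abs_le.2 ⟨by linarith [hx.1], by linarith [hx.2]⟩⟩

lemma rpow_mul_le_one {r ρ x : ℝ} (hr : 0 ≤ r) (hρ : 1 / 2 ≤ ρ) (hx : 1 ≤ x)
    (h : r * x ^ 2 ≤ 1) : r ^ ρ * x ≤ 1 := by
  have hr1 : r ≤ 1 :=
    (le_mul_of_one_le_right hr (one_le_pow₀ hx)).trans h
  calc r ^ ρ * x ≤ √r * x := by
        rw [Real.sqrt_eq_rpow]
        gcongr ?_ * x
        exact Real.rpow_le_rpow_of_exponent_ge_of_imp hr hr1 hρ fun _ h0 => by linarith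
    _ ≤ 1 := abs_le_one_iff_mul_self_le_one.2 (by
        rw [mul_mul_mul_comm, Real.mul_self_sqrt hr]; linarith) |> (le_abs_self _).trans

lemma mul_rpow_exp_le_sum {N : ℕ} (hN : 0 < N) {β h E q : ℝ} (hβ : 0 ≤ β) (hβ1 : β ≤ 1)
    {ν J : Finset ℕ} (hJ : J ⊆ ν) {F G : ℕ → ℝ} (hF : ∀ k ∈ ν, 0 ≤ F k) (hFJ : ∀ k ∈ J, q ≤ F k) (hq : 0 ≤ q)
    (hE : 0 ≤ E) (hG : ∀ k ∈ J, (G k - h) * Real.log N ≤ E) :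
    J.card * (q * ((N : ℝ) ^ (-(β * h)) * Real.exp (-E))) ≤
      ∑ k ∈ ν, F k * (N : ℝ) ^ (-(β * G k)) := by
  have hN' : (0 : ℝ) < N := by exact_mod_cast hN
  rw [← nsmul_eq_mul]
  refine (Finset.card_nsmul_le_sum J _ _ fun k hk => ?_).trans
    (Finset.sum_le_sum_of_subset_of_nonneg hJ fun k hk _ => mul_nonneg (hF k hk) (by positivity))
  refine mul_le_mul (hFJ k hk) ?_ (by positivity) (hq.trans (hFJ k hk))
  rw [Real.rpow_def_of_pos hN', Real.rpow_def_of_pos hN', ← Real.exp_add]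
  refine Real.exp_le_exp.2 ?_
  have := mul_le_mul_of_nonneg_left (hG k hk) hβ
  nlinarith

/-- There is a constant `c > 0` (not depending on `I` and `N`)
such that for every compact interval `I = [u,w] ⊆ [0,1]` and every `N ≥ 4` with
`λ(I) ≥ 4(L+1)N^{−1}(log N)²`,
`(Σ_{k∈ν_N(I)} ‖Φ_α(·,H(k/N))‖_{L^α(ℝ)}^β·N^{−βH(k/N)})^{−1}
  ≤ c·|ν_N(I)|^{−1}·N^{βH̲(I)}·(log N)²`, where `H̲(I) = min_{t∈I} H(t)`. -/
theorem inverse_weighted_power_sum_upper_bound (α : ℝ)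
    (hα : α ∈ Set.Ioo (1 : ℝ) 2) (L : ℕ) (hL : 2 ≤ L) (β : ℝ)
    (hβ : β ∈ Set.Ioc (0 : ℝ) (1 / 4)) (Hlow Hup : ℝ) (h0 : 1 / α < Hlow)
    (h1 : Hlow ≤ Hup) (h2 : Hup < 1) (H : ℝ → ℝ)
    (hH : ∀ t ∈ Set.Icc (0 : ℝ) 1, H t ∈ Set.Icc Hlow Hup) (cH ρ : ℝ)
    (hcH : 0 < cH) (hρ0 : Hup < ρ) (hρ1 : ρ ≤ 1)
    (hHol : ∀ t₁ ∈ Set.Icc (0 : ℝ) 1, ∀ t₂ ∈ Set.Icc (0 : ℝ) 1,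
      |H t₁ - H t₂| ≤ cH * |t₁ - t₂| ^ ρ) :
    ∃ c > (0 : ℝ), ∀ u w : ℝ, 0 ≤ u → u < w → w ≤ 1 → ∀ N : ℕ, 4 ≤ N →
      4 * ((L : ℝ) + 1) * (Real.log N) ^ 2 / N ≤ w - u →
      let ν : Finset ℕ :=
        (Finset.range (N - L + 1)).filter fun k => (k : ℝ) / N ∈ Set.Icc u w
      (∑ k ∈ ν, PhiNorm α L (H ((k : ℝ) / N)) ^ β *
          (N : ℝ) ^ (-(β * H ((k : ℝ) / N))))⁻¹ ≤
        c * ((ν.card : ℝ))⁻¹ * (N : ℝ) ^ (β * sInf (H '' Set.Icc u w)) *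
          (Real.log N) ^ 2 := by
  obtain ⟨hβ0, hβ1⟩ := hβ
  have hL0 : L ≠ 0 := by omega
  have hρ2 : 1 / 2 ≤ ρ := by
    have : 1 / 2 ≤ 1 / α := one_div_le_one_div_of_le (by linarith [hα.1]) hα.2.le
    linarith
  refine ⟨64 * Real.exp (1 + cH), by positivity, fun u w hu huw hw N hN hlen => ?_⟩
  intro ν
  have hN0 : 0 < N := by omega
  have hN' : (0 : ℝ) < N := by exact_mod_cast hN0
  have hlog : 1 ≤ Real.log N := by
    rw [Real.le_log_iff_exp_le hN']
    have : (4 : ℝ) ≤ N := by exact_mod_cast hN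
    linarith [Real.exp_one_lt_d9]
  set ℓ := Real.log N
  have hℓ2 : 1 ≤ ℓ ^ 2 := one_le_pow₀ hlog
  have hLnn : (0 : ℝ) ≤ L := L.cast_nonneg
  rw [div_le_iff₀ hN'] at hlen
  have hLN : L ≤ N := by
    have : (L : ℝ) ≤ N := by nlinarith
    exact_mod_cast this
  set r := (w - u) / (2 * ℓ ^ 2) with hr
  have hrℓ : r * ℓ ^ 2 = (w - u) / 2 := by rw [hr]; field_simp
  have hr0 : 0 ≤ r := by have := sub_nonneg.2 huw.le; positivity
  have hNr : 2 * ((L : ℝ) + 1) ≤ N * r := by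
    refine le_of_mul_le_mul_right ?_ (lt_of_lt_of_le one_pos hℓ2)
    rw [mul_assoc (N : ℝ), hrℓ]
    linarith
  have hne : (H '' Set.Icc u w).Nonempty := (Set.nonempty_Icc.2 huw.le).image H
  obtain ⟨_, ⟨t, ht, rfl⟩, htinf⟩ := exists_lt_of_csInf_lt hne
    (lt_add_of_pos_right (sInf (H '' Set.Icc u w)) (inv_pos.2 (lt_of_lt_of_le one_pos hlog)))
  set h := sInf (H '' Set.Icc u w)
  obtain ⟨a, hua, haw, hnear⟩ := exists_Icc_add_subset_near ht hr0 (by nlinarith)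
  let J := (Finset.range (N - L + 1)).filter fun k : ℕ => (k : ℝ) / N ∈ Set.Icc a (a + r)
  have hJν : J ⊆ ν := Finset.monotone_filter_right _ fun k _ hk =>
    ⟨hua.trans hk.1, hk.2.trans haw⟩
  have hJcard : (ν.card : ℝ) ≤ 8 * ℓ ^ 2 * J.card := by
    have hlow := le_card_filter_div_mem_Icc hN0 hLN (hu.trans hua) (haw.trans hw)
    have hup := card_filter_div_mem_Icc_le hN0 (Finset.range (N - L + 1)) hu huw.le
    have hlow' : (N : ℝ) * r / 2 ≤ J.card := by
      rw [add_sub_cancel_left] at hlow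
      linarith
    have hNw : (N : ℝ) * (w - u) = 2 * (N * r * ℓ ^ 2) := by linear_combination (-2 * N) * hrℓ
    have := mul_le_mul_of_nonneg_right hlow' (by positivity : 0 ≤ ℓ ^ 2)
    have : 2 * ((L : ℝ) + 1) * 1 ≤ N * r * ℓ ^ 2 := by gcongr
    linarith
  have hJpos : (0 : ℝ) < ν.card := by
    have hlow := le_card_filter_div_mem_Icc hN0 hLN hu hw (L := L)
    refine lt_of_lt_of_le ?_ hlow
    nlinarith
  have hmem : ∀ k ∈ ν, (k : ℝ) / N ∈ Set.Icc (0 : ℝ) 1 := fun k hk =>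
    ⟨hu.trans (Finset.mem_filter.1 hk).2.1, (Finset.mem_filter.1 hk).2.2.trans hw⟩
  have hPhi : ∀ k ∈ ν, 1 / 8 ≤ PhiNorm α L (H ((k : ℝ) / N)) ^ β := fun k hk => by
    have hHk := hH _ (hmem k hk)
    have hP := one_eighth_le_PhiNorm hα hL0 (h0.trans_le hHk.1) (hHk.2.trans_lt h2)
    calc (1 / 8 : ℝ) = (1 / 8) ^ (1 : ℝ) := (Real.rpow_one _).symm
      _ ≤ (1 / 8) ^ β :=
        Real.rpow_le_rpow_of_exponent_ge (by norm_num) (by norm_num) (by linarith)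
      _ ≤ _ := Real.rpow_le_rpow (by norm_num) hP hβ0.le
  have hosc : ∀ k ∈ J, (H ((k : ℝ) / N) - h) * ℓ ≤ 1 + cH := fun k hk => by
    have hd := hnear _ (Finset.mem_filter.1 hk).2
    have hHd : H ((k : ℝ) / N) - H t ≤ cH * r ^ ρ :=
      (le_abs_self _).trans ((hHol _ (hmem k (hJν hk)) t ⟨hu.trans ht.1, ht.2.trans hw⟩).trans
        (mul_le_mul_of_nonneg_left (Real.rpow_le_rpow (abs_nonneg _) hd (by linarith)) hcH.le))
    calc (H ((k : ℝ) / N) - h) * ℓ ≤ (ℓ⁻¹ + cH * r ^ ρ) * ℓ := by gcongr; linarith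
      _ = 1 + cH * (r ^ ρ * ℓ) := by field_simp
      _ ≤ 1 + cH := by
        have := mul_le_mul_of_nonneg_left
          (rpow_mul_le_one hr0 hρ2 hlog (by linarith)) hcH.le
        linarith
  have hsum := mul_rpow_exp_le_sum hN0 hβ0.le (by linarith) hJν
    (fun k hk => (by norm_num : (0 : ℝ) ≤ 1 / 8).trans (hPhi k hk))
    (fun k hk => hPhi k (hJν hk)) (by norm_num) (by linarith) hosc
  have hlower : ν.card / (8 * ℓ ^ 2) * (1 / 8 * ((N : ℝ) ^ (-(β * h)) * Real.exp (-(1 + cH)))) ≤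
      ∑ k ∈ ν, PhiNorm α L (H ((k : ℝ) / N)) ^ β * (N : ℝ) ^ (-(β * H ((k : ℝ) / N))) := by
    refine le_trans (mul_le_mul_of_nonneg_right ?_ (by positivity)) hsum
    rw [div_le_iff₀ (by positivity)]
    linarith
  refine (inv_anti₀ (by positivity) hlower).trans (le_of_eq ?_)
  rw [Real.rpow_neg hN'.le, Real.exp_neg]
  field_simp
  norm_num
end
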